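/- Let R be a commutative Noetherian ring, 𝔞 an ideal of R, and M a finitely generated R-module. Let t, n₀ be positive integers such that 𝔞^{n₀}·H^i_𝔞(M) = 0 for all i < t. Then for every 𝔞-filter regular element x ∈ 𝔞^{2n₀} of M and every i < t−1, there is an isomorphism of R-modules H^i_𝔞(M/xM) ≅ H^i_𝔞(M) ⊕ H^{i+1}_𝔞(M). -/

import Mathlib

open CategoryTheory

namespace LCSplit
open Limits Opposite

variable {R : Type} [CommRing R]

lemma extMk_eq_zero_iff' {X Y : ModuleCat.{0} R} (P : ProjectiveResolution X) (i : ℕ)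
    (f : P.complex.X i ⟶ Y) (hf : P.complex.d (i+1) i ≫ f = 0) :
    P.extMk f (i+1) rfl hf = 0 ↔
      ∃ g : P.complex.X ((ComplexShape.down ℕ).next i) ⟶ Y, P.complex.d i _ ≫ g = f := by
  cases i with
  | succ p =>
    rw [P.extMk_eq_zero_iff f (p+1+1) rfl hf p rfl]
    have hn : (ComplexShape.down ℕ).next (p + 1) = p := (ComplexShape.down ℕ).next_eq' (by simp)
    rw [hn]
  | zero =>
    have hn : (ComplexShape.down ℕ).next 0 = 0 := by
      simp
    constructor
    · intro h
      refine ⟨0, ?_⟩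
      rw [Limits.comp_zero]
      rw [← P.extEquivCohomologyClass.apply_eq_iff_eq,
        ProjectiveResolution.extEquivCohomologyClass_extMk,
        ProjectiveResolution.extEquivCohomologyClass_zero,
        CochainComplex.HomComplex.CohomologyClass.mk_eq_zero_iff,
        CochainComplex.HomComplex.Cocycle.toSingleMk_mem_coboundaries_iff _ _ _ _ _ 1 (by simp)] at h
      obtain ⟨g, hg⟩ := h
      have : P.cochainComplex.d (-((0:ℕ):ℤ)) 1 = 0 := by
        apply IsZero.eq_of_tgt
        exact CochainComplex.isZero_of_isStrictlyLE _ 0 1 (by simp)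
      rw [this, Limits.zero_comp] at hg
      rw [← cancel_epi (P.cochainComplexXIso (-((0:ℕ):ℤ)) 0 rfl).hom, ← hg, Limits.comp_zero]
    · rintro ⟨g, rfl⟩
      have : P.complex.d 0 ((ComplexShape.down ℕ).next 0) = 0 := by
        apply HomologicalComplex.shape
        rw [hn]; simp
      simp

lemma smul_extMk {X Y : ModuleCat.{0} R} (P : ProjectiveResolution X) (i : ℕ)
    (f : P.complex.X i ⟶ Y) (hf : P.complex.d (i+1) i ≫ f = 0) (r : R) :
    r • P.extMk f (i+1) rfl hf = P.extMk (r • f) (i+1) rfl (by simp [hf]) := by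
  rw [Abelian.Ext.smul_eq_comp_mk₀, ProjectiveResolution.extMk_comp_mk₀]
  simp

/-- The complex computing old Ext. -/
noncomputable abbrev yc {X : ModuleCat.{0} R} (P : ProjectiveResolution X) (Y : ModuleCat.{0} R) :=
    (((linearYoneda R (ModuleCat.{0} R)).obj Y).rightOp.mapHomologicalComplex
      (ComplexShape.down ℕ)).obj P.complex

noncomputable abbrev Zc {X : ModuleCat.{0} R} (P : ProjectiveResolution X) (Y : ModuleCat.{0} R)
    (i : ℕ) : ModuleCat.{0} R := ((yc P Y).opcycles i).unop

noncomputable def incZ {X : ModuleCat.{0} R} (P : ProjectiveResolution X) (Y : ModuleCat.{0} R)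
    (i : ℕ) : Zc P Y i →ₗ[R] (P.complex.X i ⟶ Y) :=
  ((yc P Y).pOpcycles i).unop.hom

noncomputable def hiso {X : ModuleCat.{0} R} (P : ProjectiveResolution X) (Y : ModuleCat.{0} R)
    (i : ℕ) : (((linearYoneda R (ModuleCat.{0} R)).obj Y).rightOp.leftDerived i).obj X ≅
      (yc P Y).homology i :=
  P.isoLeftDerivedObj ((linearYoneda R (ModuleCat.{0} R)).obj Y).rightOp i

lemma hiso_nat {X X' : ModuleCat.{0} R} (P : ProjectiveResolution X) (P' : ProjectiveResolution X')
    (Y : ModuleCat.{0} R) (i : ℕ) (g : X' ⟶ X) (φ : P'.complex ⟶ P.complex)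
    (comm : φ.f 0 ≫ P.π.f 0 = P'.π.f 0 ≫ g) :
    (((linearYoneda R (ModuleCat.{0} R)).obj Y).rightOp.leftDerived i).map g ≫ (hiso P Y i).hom =
      (hiso P' Y i).hom ≫ HomologicalComplex.homologyMap
        ((((linearYoneda R (ModuleCat.{0} R)).obj Y).rightOp.mapHomologicalComplex
      (ComplexShape.down ℕ)).map φ) i :=
  ProjectiveResolution.isoLeftDerivedObj_hom_naturality g P' P φ comm
      ((linearYoneda R (ModuleCat.{0} R)).obj Y).rightOp i

noncomputable def qZ {X : ModuleCat.{0} R} (P : ProjectiveResolution X) (Y : ModuleCat.{0} R)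
    (i : ℕ) : Zc P Y i →ₗ[R] (((_root_.Ext R (ModuleCat.{0} R) i).obj (op X)).obj Y) :=
  ((hiso P Y i).hom ≫ (yc P Y).homologyι i).unop.hom

lemma incZ_inj {X : ModuleCat.{0} R} (P : ProjectiveResolution X) (Y : ModuleCat.{0} R)
    (i : ℕ) : Function.Injective (incZ P Y i) := by
  exact (ModuleCat.mono_iff_injective ((yc P Y).pOpcycles i).unop).1 inferInstance

lemma qZ_surj {X : ModuleCat.{0} R} (P : ProjectiveResolution X) (Y : ModuleCat.{0} R)
    (i : ℕ) : Function.Surjective (qZ P Y i) := by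
  refine (ModuleCat.epi_iff_surjective (((hiso P Y i).hom ≫ (yc P Y).homologyι i).unop)).1 ?_
  rw [unop_comp]
  infer_instance

lemma incZ_range {X : ModuleCat.{0} R} (P : ProjectiveResolution X) (Y : ModuleCat.{0} R)
    (i : ℕ) (f : P.complex.X i ⟶ Y) :
    (∃ z, incZ P Y i z = f) ↔ P.complex.d (i+1) i ≫ f = 0 := by
  have h := ((ShortComplex.exact_of_g_is_cokernel
    (ShortComplex.mk _ _ ((yc P Y).d_pOpcycles (i+1) i)))
    ((yc P Y).opcyclesIsCokernel (i+1) i (by simp))).unop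
  rw [ShortComplex.moduleCat_exact_iff] at h
  constructor
  · rintro ⟨z, rfl⟩
    have := (yc P Y).d_pOpcycles (i+1) i
    have := congr_arg Quiver.Hom.unop this
    exact congr_arg (fun t => t.hom z) this
  · intro hf
    exact h f hf

lemma qZ_ker {X : ModuleCat.{0} R} (P : ProjectiveResolution X) (Y : ModuleCat.{0} R)
    (i : ℕ) (z : Zc P Y i) :
    qZ P Y i z = 0 ↔ ∃ g : P.complex.X ((ComplexShape.down ℕ).next i) ⟶ Y,
      P.complex.d i _ ≫ g = incZ P Y i z := by
  have h := ((ShortComplex.exact_of_f_is_kernel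
    (ShortComplex.mk _ _ ((yc P Y).homologyι_comp_fromOpcycles i _)))
    ((yc P Y).homologyIsKernel i _ rfl)).unop
  rw [ShortComplex.moduleCat_exact_iff] at h
  have h1 : ∀ g : P.complex.X ((ComplexShape.down ℕ).next i) ⟶ Y,
      incZ P Y i (((yc P Y).fromOpcycles i ((ComplexShape.down ℕ).next i)).unop.hom g) = P.complex.d i _ ≫ g := by
    intro g
    have := congr_arg Quiver.Hom.unop ((yc P Y).p_fromOpcycles i ((ComplexShape.down ℕ).next i))
    exact congr_arg (fun t => t.hom g) this
  have h2 : ∀ z, qZ P Y i z = 0 ↔ ((yc P Y).homologyι i).unop.hom z = 0 := by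
    intro z
    have hinj := (ModuleCat.mono_iff_injective
      (hiso P Y i).hom.unop).1 inferInstance
    constructor
    · intro hz
      apply hinj
      exact Eq.trans hz (map_zero (hiso P Y i).hom.unop.hom).symm
    · intro hz
      change (hiso P Y i).hom.unop.hom (((yc P Y).homologyι i).unop.hom z) = 0
      rw [hz]
      exact map_zero (hiso P Y i).hom.unop.hom
  rw [h2]
  constructor
  · intro hz
    obtain ⟨g, hg⟩ := h z hz
    exact ⟨g, (h1 g).symm.trans (congr_arg (incZ P Y i) hg)⟩
  · rintro ⟨g, hg⟩
    rw [← h1] at hg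
    rw [← incZ_inj P Y i hg]
    have := congr_arg Quiver.Hom.unop ((yc P Y).homologyι_comp_fromOpcycles i ((ComplexShape.down ℕ).next i))
    exact congr_arg (fun t => t.hom g) this

lemma incZ_cocycle {X : ModuleCat.{0} R} (P : ProjectiveResolution X) (Y : ModuleCat.{0} R)
    (i : ℕ) (z : Zc P Y i) : P.complex.d (i+1) i ≫ incZ P Y i z = 0 :=
  (incZ_range P Y i _).1 ⟨z, rfl⟩

noncomputable def mZ {X : ModuleCat.{0} R} (P : ProjectiveResolution X) (Y : ModuleCat.{0} R)
    (i : ℕ) : Zc P Y i →ₗ[R] Abelian.Ext X Y i where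
  toFun z := P.extMk (incZ P Y i z) (i+1) rfl (incZ_cocycle P Y i z)
  map_add' a b := by
    rw [ProjectiveResolution.add_extMk]; congr 1; simp
  map_smul' r a := by
    rw [RingHom.id_apply, smul_extMk]; congr 1; simp

lemma mZ_surj {X : ModuleCat.{0} R} (P : ProjectiveResolution X) (Y : ModuleCat.{0} R)
    (i : ℕ) : Function.Surjective (mZ P Y i) := by
  intro e
  obtain ⟨f, hf, rfl⟩ := P.extMk_surjective e (i+1) rfl
  obtain ⟨z, rfl⟩ := (incZ_range P Y i f).2 hf
  exact ⟨z, rfl⟩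

lemma ker_eq {X : ModuleCat.{0} R} (P : ProjectiveResolution X) (Y : ModuleCat.{0} R)
    (i : ℕ) : LinearMap.ker (qZ P Y i) = LinearMap.ker (mZ P Y i) := by
  ext z
  rw [LinearMap.mem_ker, LinearMap.mem_ker, qZ_ker]
  exact (extMk_eq_zero_iff' P i _ (incZ_cocycle P Y i z)).symm

noncomputable def cmp {X : ModuleCat.{0} R} (P : ProjectiveResolution X) (Y : ModuleCat.{0} R)
    (i : ℕ) : (((_root_.Ext R (ModuleCat.{0} R) i).obj (op X)).obj Y) ≃ₗ[R] Abelian.Ext X Y i :=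
  ((qZ P Y i).quotKerEquivOfSurjective (qZ_surj P Y i)).symm ≪≫ₗ
    Submodule.quotEquivOfEq _ _ (ker_eq P Y i) ≪≫ₗ
    (mZ P Y i).quotKerEquivOfSurjective (mZ_surj P Y i)

lemma cmp_qZ {X : ModuleCat.{0} R} (P : ProjectiveResolution X) (Y : ModuleCat.{0} R)
    (i : ℕ) (z : Zc P Y i) : cmp P Y i (qZ P Y i z) = mZ P Y i z := by
  have : ((qZ P Y i).quotKerEquivOfSurjective (qZ_surj P Y i)).symm (qZ P Y i z) =
      Submodule.Quotient.mk z := by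
    rw [LinearEquiv.symm_apply_eq]; rfl
  simp only [cmp, LinearEquiv.trans_apply, this]
  rfl

lemma cmp_nat {X X' : ModuleCat.{0} R} (P : ProjectiveResolution X) (P' : ProjectiveResolution X')
    (Y : ModuleCat.{0} R) (i : ℕ) (g : X' ⟶ X)
    (e : ((_root_.Ext R (ModuleCat.{0} R) i).obj (op X)).obj Y) :
    cmp P' Y i ((((_root_.Ext R (ModuleCat.{0} R) i).map g.op).app Y).hom e) =
      (Abelian.Ext.mk₀ g).comp (cmp P Y i e) (zero_add i) := by
  obtain ⟨z, rfl⟩ := qZ_surj P Y i e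
  have hcomm : (ProjectiveResolution.lift g P' P).f 0 ≫ P.π.f 0 = P'.π.f 0 ≫ g := by
    exact ProjectiveResolution.lift_commutes_zero g P' P
  let φ : ProjectiveResolution.Hom P' P g := 
    { hom := ProjectiveResolution.lift g P' P
      hom_f_zero_comp_π_f_zero := hcomm }
  let Φ := (((linearYoneda R (ModuleCat.{0} R)).obj Y).rightOp.mapHomologicalComplex
      (ComplexShape.down ℕ)).map φ.hom
  let z' : Zc P' Y i := (HomologicalComplex.opcyclesMap Φ i).unop.hom z
  have h1 : incZ P' Y i z' = φ.hom.f i ≫ incZ P Y i z := by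
    have := congr_arg Quiver.Hom.unop (HomologicalComplex.p_opcyclesMap Φ i)
    exact congr_arg (fun t => t.hom z) this
  have h2 : (((_root_.Ext R (ModuleCat.{0} R) i).map g.op).app Y).hom (qZ P Y i z) = qZ P' Y i z' := by
    have e1 := hiso_nat P P' Y i g φ.hom hcomm
    have e2 := HomologicalComplex.homologyι_naturality Φ i
    have e3 : (((linearYoneda R (ModuleCat.{0} R)).obj Y).rightOp.leftDerived i).map g ≫
      ((hiso P Y i).hom ≫
        (yc P Y).homologyι i) =
      ((hiso P' Y i).hom ≫
        (yc P' Y).homologyι i) ≫ HomologicalComplex.opcyclesMap Φ i := by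
      rw [← Category.assoc, e1, Category.assoc, Category.assoc, e2]
    have := congr_arg Quiver.Hom.unop e3
    exact congr_arg (fun t => t.hom z) this
  refine (congr_arg (cmp P' Y i) h2).trans ?_
  rw [cmp_qZ, cmp_qZ]
  have h3 := ProjectiveResolution.mk₀_comp_extMk (R := P) (incZ P Y i z) (i+1) rfl
    (incZ_cocycle P Y i z) φ
  refine Eq.trans ?_ h3.symm
  have h4 : ∀ (f f' : P'.complex.X i ⟶ Y) (hf) (hf'), f = f' →
      P'.extMk f (i+1) rfl hf = P'.extMk f' (i+1) rfl hf' := by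
    rintro f _ _ _ rfl; rfl
  exact h4 _ _ (incZ_cocycle P' Y i z') (h1 ▸ incZ_cocycle P' Y i z') h1

end LCSplit

namespace LCSplit
open Limits Opposite

variable {R : Type} [CommRing R] (I : Ideal R)

/-- `R ⧸ I ^ n` -/
abbrev Rq (n : ℕ) : ModuleCat.{0} R := ModuleCat.of R (R ⧸ I ^ n)

/-- transition map -/
def tr {m n : ℕ} (h : m ≤ n) : Rq I n ⟶ Rq I m :=
  ModuleCat.ofHom (Submodule.mapQ _ _ LinearMap.id (Ideal.pow_le_pow_right h))

lemma tr_comp {l m n : ℕ} (h : l ≤ m) (h' : m ≤ n) : tr I h' ≫ tr I h = tr I (h.trans h') := by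
  ext; rfl

lemma tr_id (n : ℕ) : tr I (le_refl n) = 𝟙 _ := by
  ext; rfl

noncomputable abbrev exT (Y : ModuleCat.{0} R) (i : ℕ) (m n : ℕ) (h : m ≤ n) :
    Abelian.Ext (Rq I m) Y i →ₗ[R] Abelian.Ext (Rq I n) Y i where
  toFun e := (Abelian.Ext.mk₀ (tr I h)).comp e (zero_add i)
  map_add' a b := by simp
  map_smul' r a := by simp

instance (Y : ModuleCat.{0} R) (i : ℕ) : DirectedSystem (fun n => Abelian.Ext (Rq I n) Y i)
    (fun m n h => exT I Y i m n h) where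
  map_self n x := by simp [tr_id]
  map_map k j i h h' x := by
    simp [← tr_comp I h h', ← Abelian.Ext.mk₀_comp_mk₀_assoc]

/-- direct limit of Ext -/
def HH (Y : ModuleCat.{0} R) (i : ℕ) : Type :=
  Module.DirectLimit (fun n => Abelian.Ext (Rq I n) Y i) (exT I Y i)

noncomputable instance (Y : ModuleCat.{0} R) (i : ℕ) : AddCommGroup (HH I Y i) :=
  inferInstanceAs (AddCommGroup
    (Module.DirectLimit (fun n => Abelian.Ext (Rq I n) Y i) (exT I Y i)))

noncomputable instance (Y : ModuleCat.{0} R) (i : ℕ) : Module R (HH I Y i) :=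
  inferInstanceAs (Module R
    (Module.DirectLimit (fun n => Abelian.Ext (Rq I n) Y i) (exT I Y i)))

noncomputable def hof (Y : ModuleCat.{0} R) (i n : ℕ) : Abelian.Ext (Rq I n) Y i →ₗ[R] HH I Y i :=
  Module.DirectLimit.of R ℕ (fun n => Abelian.Ext (Rq I n) Y i) (exT I Y i) n

lemma hof_zero {Y : ModuleCat.{0} R} {i n : ℕ} {e : Abelian.Ext (Rq I n) Y i}
    (h : hof I Y i n e = 0) : ∃ (m : ℕ) (h : n ≤ m),
      (Abelian.Ext.mk₀ (tr I h)).comp e (zero_add i) = 0 :=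
  Module.DirectLimit.of.zero_exact (G := fun n => Abelian.Ext (Rq I n) Y i) (f := exT I Y i) h

lemma hof_tr {Y : ModuleCat.{0} R} {i n m : ℕ} (h : n ≤ m) (e : Abelian.Ext (Rq I n) Y i) :
    hof I Y i m ((Abelian.Ext.mk₀ (tr I h)).comp e (zero_add i)) = hof I Y i n e :=
  Module.DirectLimit.of_f (G := fun n => Abelian.Ext (Rq I n) Y i) (f := exT I Y i) (hij := h)

lemma hof_surj {Y : ModuleCat.{0} R} {i : ℕ} (x : HH I Y i) : ∃ n e, hof I Y i n e = x :=
  Module.DirectLimit.exists_of x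

noncomputable def oldCocone (Y : ModuleCat.{0} R) (i : ℕ) :
    Cocone (localCohomology.diagram (localCohomology.idealPowersDiagram I) i ⋙
      (evaluation _ _).obj Y) :=
  ((evaluation (ModuleCat.{0} R) (ModuleCat.{0} R)).obj Y).mapCocone
    (colimit.cocone (localCohomology.diagram (localCohomology.idealPowersDiagram I) i))

noncomputable def oldIsColimit (Y : ModuleCat.{0} R) (i : ℕ) :
    IsColimit (oldCocone I Y i) :=
  isColimitOfPreserves _ (colimit.isColimit _)

noncomputable def cmpn (Y : ModuleCat.{0} R) (i n : ℕ) :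
    (((_root_.Ext R (ModuleCat.{0} R) i).obj (op (Rq I n))).obj Y) ≃ₗ[R]
      Abelian.Ext (Rq I n) Y i :=
  cmp (projectiveResolution (Rq I n)) Y i

noncomputable def legs (Y : ModuleCat.{0} R) (i n : ℕ) :
    (((_root_.Ext R (ModuleCat.{0} R) i).obj (op (Rq I n))).obj Y) →ₗ[R]
      ((localCohomology I i).obj Y) :=
  ((oldCocone I Y i).ι.app (op (op n))).hom

lemma legs_tr (Y : ModuleCat.{0} R) (i : ℕ) {m n : ℕ} (h : m ≤ n)
    (e : ((_root_.Ext R (ModuleCat.{0} R) i).obj (op (Rq I m))).obj Y) :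
    legs I Y i n ((((_root_.Ext R (ModuleCat.{0} R) i).map (tr I h).op).app Y).hom e) =
      legs I Y i m e := by
  have := (oldCocone I Y i).w (show op (op m) ⟶ op (op n) from (homOfLE h).op.op)
  exact congr_arg (fun t => t.hom e) this

lemma legs_surj (Y : ModuleCat.{0} R) (i : ℕ) (x : (localCohomology I i).obj Y) :
    ∃ n e, legs I Y i n e = x := by
  obtain ⟨⟨⟨n⟩⟩, e, h⟩ := Concrete.isColimit_exists_rep _ (oldIsColimit I Y i) x
  exact ⟨n, e, h⟩

lemma legs_zero (Y : ModuleCat.{0} R) (i m : ℕ) (e) (h : legs I Y i m e = 0) :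
    ∃ (n : ℕ) (h : m ≤ n),
      (((_root_.Ext R (ModuleCat.{0} R) i).map (tr I h).op).app Y).hom e = 0 := by
  obtain ⟨⟨⟨n⟩⟩, f, g, hh⟩ := Concrete.isColimit_exists_of_rep_eq _ (oldIsColimit I Y i)
    (i := op (op m)) (j := op (op m)) e 0 (h.trans (map_zero (legs I Y i m)).symm)
  refine ⟨n, leOfHom f.unop.unop, ?_⟩
  refine Eq.trans hh ?_
  exact map_zero ((localCohomology.diagram (localCohomology.idealPowersDiagram I) i ⋙
      (evaluation _ _).obj Y).map g).hom

lemma cmpn_tr (Y : ModuleCat.{0} R) (i : ℕ) {m n : ℕ} (h : m ≤ n)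
    (e : ((_root_.Ext R (ModuleCat.{0} R) i).obj (op (Rq I m))).obj Y) :
    cmpn I Y i n ((((_root_.Ext R (ModuleCat.{0} R) i).map (tr I h).op).app Y).hom e) =
      exT I Y i m n h (cmpn I Y i m e) :=
  cmp_nat _ _ _ _ _ _

noncomputable def toOld (Y : ModuleCat.{0} R) (i : ℕ) : HH I Y i →ₗ[R] (localCohomology I i).obj Y :=
  Module.DirectLimit.lift R ℕ _ _ (fun n => (legs I Y i n).comp (cmpn I Y i n).symm.toLinearMap) (by
    intro m n h e
    obtain ⟨e, rfl⟩ := (cmpn I Y i m).surjective e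
    rw [← cmpn_tr]
    simp only [LinearMap.comp_apply, LinearEquiv.coe_coe, LinearEquiv.symm_apply_apply]
    exact legs_tr I Y i h e)

lemma toOld_hof (Y : ModuleCat.{0} R) (i n : ℕ) (e) :
    toOld I Y i (hof I Y i n (cmpn I Y i n e)) = legs I Y i n e := by
  unfold toOld hof
  refine (Module.DirectLimit.lift_of (G := fun n => Abelian.Ext (Rq I n) Y i)
    (f := exT I Y i) _ _ _).trans ?_
  simp

lemma toOld_bij (Y : ModuleCat.{0} R) (i : ℕ) : Function.Bijective (toOld I Y i) := by
  constructor
  · rw [injective_iff_map_eq_zero]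
    intro a ha
    obtain ⟨m, e, rfl⟩ := hof_surj I a
    obtain ⟨e, rfl⟩ := (cmpn I Y i m).surjective e
    rw [toOld_hof] at ha
    obtain ⟨n, h, hh⟩ := legs_zero I Y i m e ha
    rw [← hof_tr I h]
    change hof I Y i n (exT I Y i m n h _) = 0
    rw [← cmpn_tr]
    refine (congr_arg _ (congr_arg _ hh)).trans ?_
    simp
  · intro x
    obtain ⟨n, e, rfl⟩ := legs_surj I Y i x
    exact ⟨_, toOld_hof I Y i n e⟩

noncomputable def oldEquiv (Y : ModuleCat.{0} R) (i : ℕ) :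
    HH I Y i ≃ₗ[R] (localCohomology I i).obj Y :=
  LinearEquiv.ofBijective (toOld I Y i) (toOld_bij I Y i)

/-- composition with an Ext class, at finite level -/
noncomputable def postn {Y Z : ModuleCat.{0} R} {i j k : ℕ} (β : Abelian.Ext Y Z j) (h : i + j = k)
    (n : ℕ) : Abelian.Ext (Rq I n) Y i →ₗ[R] Abelian.Ext (Rq I n) Z k where
  toFun e := e.comp β h
  map_add' := by simp
  map_smul' := by simp

/-- composition with an Ext class -/
noncomputable def post {Y Z : ModuleCat.{0} R} {i j k : ℕ} (β : Abelian.Ext Y Z j) (h : i + j = k) :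
    HH I Y i →ₗ[R] HH I Z k :=
  Module.DirectLimit.map (G := fun n => Abelian.Ext (Rq I n) Y i) (f := exT I Y i)
    (G' := fun n => Abelian.Ext (Rq I n) Z k) (f' := exT I Z k) (postn I β h) (by
    intro m n hmn
    ext e
    simp only [LinearMap.comp_apply, postn, LinearMap.coe_mk, AddHom.coe_mk]
    rw [Abelian.Ext.comp_assoc (a₁₂ := i) (a₂₃ := k)]
    omega)

@[simp]
lemma post_hof {Y Z : ModuleCat.{0} R} {i j k : ℕ} (β : Abelian.Ext Y Z j) (h : i + j = k) (n : ℕ)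
    (e : Abelian.Ext (Rq I n) Y i) : post I β h (hof I Y i n e) = hof I Z k n (e.comp β h) :=
  Module.DirectLimit.map_apply_of (G := fun n => Abelian.Ext (Rq I n) Y i) (f := exT I Y i)
    (G' := fun n => Abelian.Ext (Rq I n) Z k) (f' := exT I Z k) (postn I β h) _ e

lemma post_post {Y Z W : ModuleCat.{0} R} {i j k l jq jj : ℕ} (β : Abelian.Ext Y Z j) (h : i + j = k)
    (γ : Abelian.Ext Z W jq) (hkl : k + jq = l) (hjj : j + jq = jj) (x : HH I Y i) :
    post I γ hkl (post I β h x) = post I (β.comp γ hjj) (show i + jj = l by omega) x := by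
  obtain ⟨n, e, rfl⟩ := hof_surj I x
  simp only [post_hof]
  rw [Abelian.Ext.comp_assoc e β γ h hjj (by omega)]

lemma post_add {Y Z : ModuleCat.{0} R} {i j k : ℕ} (β γ : Abelian.Ext Y Z j) (h : i + j = k)
    (x : HH I Y i) : post I (β + γ) h x = post I β h x + post I γ h x := by
  obtain ⟨n, e, rfl⟩ := hof_surj I x
  simp

lemma post_zero {Y Z : ModuleCat.{0} R} {i j k : ℕ} (h : i + j = k)
    (x : HH I Y i) : post I (0 : Abelian.Ext Y Z j) h x = 0 := by
  obtain ⟨n, e, rfl⟩ := hof_surj I x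
  simp

lemma post_smul {Y Z : ModuleCat.{0} R} {i j k : ℕ} (r : R) (β : Abelian.Ext Y Z j) (h : i + j = k)
    (x : HH I Y i) : post I (r • β) h x = r • post I β h x := by
  obtain ⟨n, e, rfl⟩ := hof_surj I x
  simp

lemma post_id {Y : ModuleCat.{0} R} {i : ℕ} (x : HH I Y i) :
    post I (Abelian.Ext.mk₀ (𝟙 Y)) (add_zero i) x = x := by
  obtain ⟨n, e, rfl⟩ := hof_surj I x
  simp

/-- functoriality -/
noncomputable abbrev hm {Y Z : ModuleCat.{0} R} (f : Y ⟶ Z) (i : ℕ) : HH I Y i →ₗ[R] HH I Z i :=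
  post I (Abelian.Ext.mk₀ f) (add_zero i)

lemma hm_comp {Y Z W : ModuleCat.{0} R} (f : Y ⟶ Z) (g : Z ⟶ W) (i : ℕ) (x : HH I Y i) :
    hm I (f ≫ g) i x = hm I g i (hm I f i x) := by
  rw [hm, hm, hm, post_post I _ _ _ _ (add_zero 0)]
  simp

lemma hm_smul {Y Z : ModuleCat.{0} R} (r : R) (f : Y ⟶ Z) (i : ℕ) (x : HH I Y i) :
    hm I (r • f) i x = r • hm I f i x := by
  rw [hm, Abelian.Ext.mk₀_smul, post_smul]

lemma hm_zero {Y Z : ModuleCat.{0} R} (i : ℕ) (x : HH I Y i) :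
    hm I (0 : Y ⟶ Z) i x = 0 := by
  rw [hm, Abelian.Ext.mk₀_zero, post_zero]

lemma hm_sum {Y Z : ModuleCat.{0} R} {ι : Type} (s : Finset ι) (f : ι → (Y ⟶ Z)) (i : ℕ)
    (x : HH I Y i) : hm I (∑ j ∈ s, f j) i x = ∑ j ∈ s, hm I (f j) i x := by
  classical
  induction s using Finset.induction_on with
  | empty => simp [hm_zero]
  | insert a s ha ih =>
    rw [Finset.sum_insert ha, Finset.sum_insert ha, hm, Abelian.Ext.mk₀_add, post_add, ih]

/-- connecting map -/
noncomputable abbrev hδ {S : ShortComplex (ModuleCat.{0} R)} (hS : S.ShortExact) (i : ℕ) :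
    HH I S.X₃ i →ₗ[R] HH I S.X₁ (i+1) := post I hS.extClass rfl

lemma hδ_nat {S T : ShortComplex (ModuleCat.{0} R)} (hS : S.ShortExact) (hT : T.ShortExact)
    (f : S ⟶ T) (i : ℕ) (x : HH I S.X₃ i) :
    hδ I hT i (hm I f.τ₃ i x) = hm I f.τ₁ (i+1) (hδ I hS i x) := by
  rw [hδ, hδ, hm, hm, post_post I _ _ _ _ (zero_add 1), post_post I _ _ _ _ (add_zero 1)]
  rw [ShortComplex.ShortExact.extClass_naturality hS hT f]

lemma ex₁ {S : ShortComplex (ModuleCat.{0} R)} (hS : S.ShortExact) (i : ℕ) (x : HH I S.X₁ (i+1))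
    (h : hm I S.f (i+1) x = 0) : ∃ y, hδ I hS i y = x := by
  obtain ⟨n, e, rfl⟩ := hof_surj I x
  rw [hm, post_hof] at h
  obtain ⟨m, hnm, h⟩ := hof_zero I h
  rw [← Abelian.Ext.comp_assoc (a₁₂ := i+1) _ _ _ (by omega) (by omega) (by omega)] at h
  obtain ⟨y, hy⟩ := Abelian.Ext.covariant_sequence_exact₁ _ hS _ h rfl
  refine ⟨hof I _ _ m y, ?_⟩
  rw [hδ, post_hof, hy, hof_tr]

lemma ex₂ {S : ShortComplex (ModuleCat.{0} R)} (hS : S.ShortExact) (i : ℕ) (x : HH I S.X₂ i)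
    (h : hm I S.g i x = 0) : ∃ y, hm I S.f i y = x := by
  obtain ⟨n, e, rfl⟩ := hof_surj I x
  rw [hm, post_hof] at h
  obtain ⟨m, hnm, h⟩ := hof_zero I h
  rw [← Abelian.Ext.comp_assoc (a₁₂ := i) _ _ _ (by omega) (by omega) (by omega)] at h
  obtain ⟨y, hy⟩ := Abelian.Ext.covariant_sequence_exact₂ _ hS _ h
  refine ⟨hof I _ _ m y, ?_⟩
  rw [hm, post_hof, hy, hof_tr]

lemma ex₃ {S : ShortComplex (ModuleCat.{0} R)} (hS : S.ShortExact) (i : ℕ) (x : HH I S.X₃ i)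
    (h : hδ I hS i x = 0) : ∃ y, hm I S.g i y = x := by
  obtain ⟨n, e, rfl⟩ := hof_surj I x
  rw [hδ, post_hof] at h
  obtain ⟨m, hnm, h⟩ := hof_zero I h
  rw [← Abelian.Ext.comp_assoc (a₁₂ := i) _ _ _ (by omega) (by omega) (by omega)] at h
  obtain ⟨y, hy⟩ := Abelian.Ext.covariant_sequence_exact₃ _ hS _ rfl h
  refine ⟨hof I _ _ m y, ?_⟩
  rw [hm, post_hof, hy, hof_tr]

lemma hδ_comp {S : ShortComplex (ModuleCat.{0} R)} (hS : S.ShortExact) (i : ℕ) (x : HH I S.X₂ i) :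
    hδ I hS i (hm I S.g i x) = 0 := by
  rw [hδ, hm, post_post I _ _ _ _ (zero_add 1), hS.comp_extClass, post_zero]

end LCSplit

namespace LCSplit
open Limits Opposite

section vanishing
variable {R : Type} [CommRing R]

/-- short complex of modules from linear maps -/
abbrev sc {A B C : Type} [AddCommGroup A] [AddCommGroup B] [AddCommGroup C]
    [Module R A] [Module R B] [Module R C] (f : A →ₗ[R] B) (g : B →ₗ[R] C)
    (h : Function.Exact f g) : ShortComplex (ModuleCat.{0} R) :=
  ShortComplex.mk (ModuleCat.ofHom f) (ModuleCat.ofHom g) (by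
    ext a; exact h.apply_apply_eq_zero a)

lemma sc_se {A B C : Type} [AddCommGroup A] [AddCommGroup B] [AddCommGroup C]
    [Module R A] [Module R B] [Module R C] (f : A →ₗ[R] B) (g : B →ₗ[R] C)
    (h : Function.Exact f g) (hf : Function.Injective f) (hg : Function.Surjective g) :
    (sc f g h).ShortExact := by
  have h1 : Mono (sc f g h).f := (ModuleCat.mono_iff_injective _).2 hf
  have h2 : Epi (sc f g h).g := (ModuleCat.epi_iff_surjective _).2 hg
  refine ShortComplex.ShortExact.mk' ?_ h1 h2
  rw [ShortComplex.moduleCat_exact_iff]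
  intro b hb
  exact (h b).1 hb

lemma step {S T : ShortComplex (ModuleCat.{0} R)} (hS : S.ShortExact) (hT : T.ShortExact)
    (φ : S ⟶ T) {G : ModuleCat.{0} R} {i j : ℕ} (f : Abelian.Ext T.X₁ G i) (hj : 1 + i = j)
    (h : (Abelian.Ext.mk₀ φ.τ₁).comp f (zero_add i) = 0) :
    (Abelian.Ext.mk₀ φ.τ₃).comp (hT.extClass.comp f hj) (zero_add j) = 0 := by
  rw [← Abelian.Ext.comp_assoc _ _ _ (zero_add 1) hj (by omega),
    ← ShortComplex.ShortExact.extClass_naturality hS hT φ,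
    Abelian.Ext.comp_assoc _ _ _ (add_zero 1) (zero_add i) (by omega), h,
    Abelian.Ext.comp_zero]

lemma fac {F : Type} [AddCommGroup F] [Module R F] (N L : Submodule R F) (J : Ideal R)
    (h : L ≤ J • N) (hLN : L ≤ N) : ∃ u : L →ₗ[R] (J • ⊤ : Submodule R N),
      (J • ⊤ : Submodule R N).subtype ∘ₗ u = Submodule.inclusion hLN := by
  have key : ∀ x : L, Submodule.inclusion hLN x ∈ (J • ⊤ : Submodule R N) := by
    intro x
    have h1 : (x : F) ∈ (J • ⊤ : Submodule R N).map N.subtype := by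
      rw [Submodule.map_smul'', Submodule.map_top, Submodule.range_subtype]
      exact h x.2
    obtain ⟨y, hy, hxy⟩ := h1
    have : Submodule.inclusion hLN x = y := Subtype.ext hxy.symm
    rw [this]; exact hy
  exact ⟨LinearMap.codRestrict _ (Submodule.inclusion hLN) key, by ext; rfl⟩

lemma fac_zero {F : Type} [AddCommGroup F] [Module R F] (N L : Submodule R F) (J : Ideal R)
    (h : L ≤ J • N) (hLN : L ≤ N) {G : ModuleCat.{0} R} {i : ℕ}
    (f : Abelian.Ext (ModuleCat.of R N) G i)
    (hf : (Abelian.Ext.mk₀ (ModuleCat.ofHom (J • ⊤ : Submodule R N).subtype)).comp f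
      (zero_add i) = 0) :
    (Abelian.Ext.mk₀ (ModuleCat.ofHom (Submodule.inclusion hLN))).comp f (zero_add i) = 0 := by
  obtain ⟨u, hu⟩ := fac N L J h hLN
  rw [← hu, ModuleCat.ofHom_comp, ← Abelian.Ext.mk₀_comp_mk₀_assoc, hf, Abelian.Ext.comp_zero]

lemma van [IsNoetherianRing R] (I : Ideal R) (G : ModuleCat.{0} R) (k : ℕ)
    (hG : ∀ r ∈ I ^ k, ∀ g : G, r • g = 0) (i : ℕ) :
    ∀ (A : Type) [AddCommGroup A] [Module R A] [Module.Finite R A]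
      (e : Abelian.Ext (ModuleCat.of R A) G i),
      ∃ m, (Abelian.Ext.mk₀ (ModuleCat.ofHom (I ^ m • ⊤ : Submodule R A).subtype)).comp e
        (zero_add i) = 0 := by
  induction i with
  | zero =>
    intro A _ _ _ e
    obtain ⟨f, rfl⟩ := (Abelian.Ext.mk₀_bijective (ModuleCat.of R A) G).2 e
    refine ⟨k, ?_⟩
    rw [Abelian.Ext.mk₀_comp_mk₀]
    have : ModuleCat.ofHom (I ^ k • ⊤ : Submodule R A).subtype ≫ f = 0 := by
      ext ⟨a, ha⟩
      change f.hom a = 0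
      induction ha using Submodule.smul_induction_on' with
      | smul r hr n hn => rw [map_smul]; exact hG r hr _
      | add x hx y hy h1 h2 => rw [map_add, h1, h2, add_zero]
    rw [this, Abelian.Ext.mk₀_zero]
  | succ i ih =>
    intro A _ _ _ e
    obtain ⟨n, p, hp⟩ := Module.Finite.exists_fin' R A
    have hT := sc_se (LinearMap.ker p).subtype p (LinearMap.exact_subtype_ker_map p)
      (Submodule.subtype_injective _) hp
    have hpr : Projective (ModuleCat.of R (Fin n → R)) :=
      (IsProjective.iff_projective _).1 inferInstance
    have h0 : (Abelian.Ext.mk₀ (ModuleCat.ofHom p)).comp e (zero_add _) = 0 :=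
      Abelian.Ext.eq_zero_of_projective _
    obtain ⟨f, rfl⟩ := Abelian.Ext.contravariant_sequence_exact₃ hT G e h0 (add_comm 1 i)
    obtain ⟨m', hm'⟩ := ih (LinearMap.ker p) f
    obtain ⟨c, hc⟩ := Ideal.exists_pow_inf_eq_pow_smul I (LinearMap.ker p)
    set m := c + m' with hm
    have hle : (I ^ m • ⊤ ⊓ LinearMap.ker p : Submodule R (Fin n → R)) ≤
        I ^ m' • LinearMap.ker p := by
      rw [hc m (by omega), hm, Nat.add_sub_cancel_left]
      exact Submodule.smul_mono le_rfl inf_le_right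
    refine ⟨m, ?_⟩
    have hmap : ∀ y ∈ (I ^ m • ⊤ : Submodule R (Fin n → R)),
        p y ∈ (I ^ m • ⊤ : Submodule R A) := by
      intro y hy
      have : p y ∈ (I ^ m • ⊤ : Submodule R (Fin n → R)).map p := ⟨y, hy, rfl⟩
      rw [Submodule.map_smul''] at this
      exact Submodule.smul_mono le_rfl le_top this
    let g1 : (I ^ m • ⊤ : Submodule R (Fin n → R)) →ₗ[R] (I ^ m • ⊤ : Submodule R A) :=
      p.restrict hmap
    let f1 : (I ^ m • ⊤ ⊓ LinearMap.ker p : Submodule R (Fin n → R)) →ₗ[R]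
      (I ^ m • ⊤ : Submodule R (Fin n → R)) := Submodule.inclusion inf_le_left
    have hex : Function.Exact f1 g1 := by
      intro y
      constructor
      · intro hy
        have : p y = 0 := congr_arg Subtype.val hy
        exact ⟨⟨y, y.2, this⟩, rfl⟩
      · rintro ⟨z, rfl⟩
        exact Subtype.ext z.2.2
    have hsurj : Function.Surjective g1 := by
      rintro ⟨a, ha⟩
      have h2 : a ∈ (I ^ m • ⊤ : Submodule R (Fin n → R)).map p := by
        rw [Submodule.map_smul'', Submodule.map_top, LinearMap.range_eq_top.2 hp]
        exact ha
      obtain ⟨y, hy, rfl⟩ := h2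
      exact ⟨⟨y, hy⟩, rfl⟩
    have hS := sc_se f1 g1 hex (Submodule.inclusion_injective _) hsurj
    let φ : sc f1 g1 hex ⟶ sc (LinearMap.ker p).subtype p (LinearMap.exact_subtype_ker_map p) :=
      { τ₁ := ModuleCat.ofHom (Submodule.inclusion inf_le_right)
        τ₂ := ModuleCat.ofHom (Submodule.subtype _)
        τ₃ := ModuleCat.ofHom (Submodule.subtype _)
        comm₁₂ := by ext; rfl
        comm₂₃ := by ext; rfl }
    exact step hS hT φ f _ (fac_zero _ _ _ hle inf_le_right f hm')

lemma HH_van [IsNoetherianRing R] (I : Ideal R) (G : ModuleCat.{0} R) (k : ℕ)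
    (hG : ∀ r ∈ I ^ k, ∀ g : G, r • g = 0) (i : ℕ) (x : HH I G (i + 1)) : x = 0 := by
  obtain ⟨n, e, rfl⟩ := hof_surj I x
  have hT : ∀ n : ℕ, (sc (I ^ n).subtype (I ^ n).mkQ
      (LinearMap.exact_subtype_mkQ _)).ShortExact := fun n => sc_se _ _ _
      (Submodule.subtype_injective _) (Submodule.mkQ_surjective _)
  have hpr : Projective (ModuleCat.of R R) :=
    (IsProjective.iff_projective _).1 inferInstance
  have h0 : (Abelian.Ext.mk₀ (ModuleCat.ofHom (I ^ n).mkQ)).comp e (zero_add _) = 0 :=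
    Abelian.Ext.eq_zero_of_projective _
  obtain ⟨f, rfl⟩ := Abelian.Ext.contravariant_sequence_exact₃ (hT n) G e h0 (add_comm 1 i)
  obtain ⟨m, hm⟩ := van I G k hG i (I ^ n : Ideal R) f
  have hle : I ^ (m + n) ≤ I ^ m • (I ^ n) := by rw [pow_add]; exact le_rfl
  have hle' : I ^ (m + n) ≤ I ^ n := Ideal.pow_le_pow_right (by omega)
  rw [← hof_tr I (show n ≤ m + n by omega)]
  let φ : sc (I ^ (m + n)).subtype (I ^ (m + n)).mkQ (LinearMap.exact_subtype_mkQ _) ⟶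
      sc (I ^ n).subtype (I ^ n).mkQ (LinearMap.exact_subtype_mkQ _) :=
    { τ₁ := ModuleCat.ofHom (Submodule.inclusion hle')
      τ₂ := 𝟙 _
      τ₃ := tr I (by omega)
      comm₁₂ := by ext; rfl
      comm₂₃ := by ext; rfl }
  have := step (hT (m + n)) (hT n) φ f (add_comm 1 i) (fac_zero _ _ _ hle hle' f hm)
  exact (congr_arg _ this).trans (map_zero _)

end vanishing
end LCSplit

namespace LCSplit
open Limits Opposite

section main
variable {R : Type} [CommRing R]

lemma tors_pow [IsNoetherianRing R] (I : Ideal R) (M : Type) [AddCommGroup M] [Module R M]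
    [Module.Finite R M] (x : R) (hfr : ∀ p ∈ associatedPrimes R M, ¬ I ≤ p → x ∉ p) :
    ∃ k, ∀ r ∈ I ^ k, ∀ g : Submodule.torsionBy R M x, r • g = 0 := by
  have h1 : I ≤ (Module.annihilator R (Submodule.torsionBy R M x)).radical := by
    rw [← Ideal.sInf_minimalPrimes]
    refine le_sInf ?_
    intro p hp
    have h2 := Module.associatedPrimes.minimalPrimes_annihilator_subset_associatedPrimes R
      (Submodule.torsionBy R M x) hp
    have h3 : p ∈ associatedPrimes R M :=
      associatedPrimes.subset_of_injective (Submodule.subtype_injective _) h2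
    by_contra h4
    refine hfr p h3 h4 (hp.1.2 ?_)
    rw [Module.mem_annihilator]
    intro m
    exact Subtype.ext m.2
  obtain ⟨k, hk⟩ := Ideal.exists_pow_le_of_le_radical_of_fg h1 (IsNoetherian.noetherian I)
  exact ⟨k, fun r hr g => Module.mem_annihilator.1 (hk hr) g⟩

lemma tors_kill (I : Ideal R) (M : Type) [AddCommGroup M] [Module R M] (k : ℕ) (m : M)
    (hm : ∀ r ∈ I ^ k, r • m = 0) (r : R) (hr : ∀ y : HH I (ModuleCat.of R M) 0, r • y = 0) :
    r • m = 0 := by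
  let f : Rq I k ⟶ ModuleCat.of R M := ModuleCat.ofHom
    ((I ^ k).liftQ (LinearMap.toSpanSingleton R M m) (by intro s hs; exact hm s hs))
  have h := hr (hof I _ 0 k (Abelian.Ext.mk₀ f))
  rw [← map_smul, ← Abelian.Ext.mk₀_smul] at h
  obtain ⟨l, hl, h⟩ := hof_zero I h
  rw [Abelian.Ext.mk₀_comp_mk₀, Abelian.Ext.mk₀_eq_zero_iff] at h
  have h' := congr_arg (fun q => q.hom (Submodule.Quotient.mk (1 : R))) h
  have : r • ((1 : R) • m) = 0 := h'
  rwa [one_smul] at this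

lemma equiv_of_split {H A B : Type} [AddCommGroup H] [AddCommGroup A] [AddCommGroup B]
    [Module R H] [Module R A] [Module R B] (f : A →ₗ[R] H) (g : H →ₗ[R] B) (s : B →ₗ[R] H)
    (hf : Function.Injective f) (hfg : ∀ a, g (f a) = 0) (hex : ∀ h, g h = 0 → ∃ a, f a = h)
    (hs : ∀ b, g (s b) = b) : Nonempty (H ≃ₗ[R] A × B) := by
  refine ⟨(LinearEquiv.ofBijective (f.coprod s) ⟨?_, ?_⟩).symm⟩
  · rw [injective_iff_map_eq_zero]
    rintro ⟨a, b⟩ h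
    rw [LinearMap.coprod_apply] at h
    have hb : b = 0 := by
      have := congr_arg g h
      rwa [map_add, hfg, hs, zero_add, map_zero] at this
    subst hb
    rw [map_zero, add_zero] at h
    have ha : a = 0 := hf (h.trans (map_zero f).symm)
    rw [ha]; rfl
  · intro h
    obtain ⟨a, ha⟩ := hex (h - s (g h)) (by rw [map_sub, hs, sub_self])
    exact ⟨(a, g h), by rw [LinearMap.coprod_apply, ha]; simp⟩

/-- section obtained by factoring through a surjection -/
lemma exists_factor {Q B H : Type} [AddCommGroup Q] [AddCommGroup B] [AddCommGroup H]
    [Module R Q] [Module R B] [Module R H] (d : Q →ₗ[R] B) (q : Q →ₗ[R] H)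
    (hd : Function.Surjective d) (hq : ∀ y, d y = 0 → q y = 0) :
    ∃ s : B →ₗ[R] H, ∀ y, s (d y) = q y := by
  let e := d.quotKerEquivOfSurjective hd
  refine ⟨((LinearMap.ker d).liftQ q (fun y hy => hq y hy)).comp e.symm.toLinearMap, ?_⟩
  intro y
  have : e.symm (d y) = (LinearMap.ker d).mkQ y := by
    rw [LinearEquiv.symm_apply_eq]; rfl
  rw [LinearMap.comp_apply, LinearEquiv.coe_coe, this]
  rfl

lemma mem_mul_sum (J K : Ideal R) (x : R) (hx : x ∈ J * K) :
    ∃ (k : ℕ) (a b : Fin k → R), (∀ j, a j ∈ J) ∧ (∀ j, b j ∈ K) ∧ x = ∑ j, a j * b j := by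
  induction hx using Submodule.mul_induction_on' with
  | mem_mul_mem m hm n hn => exact ⟨1, fun _ => m, fun _ => n, fun _ => hm, fun _ => hn, by simp⟩
  | add x hx y hy h1 h2 =>
    obtain ⟨k, a, b, ha, hb, rfl⟩ := h1
    obtain ⟨l, c, d, hc, hd, rfl⟩ := h2
    refine ⟨k + l, Fin.append a c, Fin.append b d, ?_, ?_, ?_⟩
    · intro j; refine Fin.addCases (fun j => ?_) (fun j => ?_) j <;> simp [ha, hc]
    · intro j; refine Fin.addCases (fun j => ?_) (fun j => ?_) j <;> simp [hb, hd]
    · simp [Fin.sum_univ_add]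

lemma surj_of_van (I : Ideal R) {S : ShortComplex (ModuleCat.{0} R)} (hS : S.ShortExact)
    (hv : ∀ (j : ℕ) (z : HH I S.X₁ (j + 1)), z = 0) (j : ℕ) :
    Function.Surjective (hm I S.g j) := fun y => ex₃ I hS j y (hv j _)

lemma equiv_of_van (I : Ideal R) {S : ShortComplex (ModuleCat.{0} R)} (hS : S.ShortExact)
    (hv : ∀ (j : ℕ) (z : HH I S.X₁ (j + 1)), z = 0) (i : ℕ) :
    Nonempty (HH I S.X₃ (i + 1) ≃ₗ[R] HH I S.X₂ (i + 1)) := by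
  refine ⟨(LinearEquiv.ofBijective (hm I S.g (i + 1)) ⟨?_, surj_of_van I hS hv _⟩).symm⟩
  rw [injective_iff_map_eq_zero]
  intro y hy
  obtain ⟨z, rfl⟩ := ex₂ I hS (i + 1) y hy
  rw [hv i z, map_zero]

lemma split_of_hom (I : Ideal R) {S T : ShortComplex (ModuleCat.{0} R)} (h1 : S.ShortExact)
    (h2 : T.ShortExact) (Ψ : S ⟶ T) [IsIso Ψ.τ₁] (i : ℕ)
    (hT0 : ∀ y, hm I T.f i y = 0) (hS0 : ∀ y, hm I S.f (i + 1) y = 0)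
    (hτ : ∀ y, hm I Ψ.τ₂ i y = 0) :
    Nonempty (HH I T.X₃ i ≃ₗ[R] HH I T.X₂ i × HH I T.X₁ (i + 1)) := by
  have hd1 : Function.Surjective (hδ I h1 i) := fun y => ex₁ I h1 i y (hS0 y)
  obtain ⟨s, hs⟩ := exists_factor (hδ I h1 i) (hm I Ψ.τ₃ i) hd1 (by
    intro y hy
    obtain ⟨z, rfl⟩ := ex₃ I h1 i y hy
    rw [← hm_comp, ← Ψ.comm₂₃, hm_comp, hτ z, map_zero])
  refine equiv_of_split (hm I T.g i) (hδ I h2 i) (s.comp (hm I (inv Ψ.τ₁) (i + 1))) ?_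
    (fun y => hδ_comp I h2 i y) (fun y hy => ex₃ I h2 i y hy) ?_
  · rw [injective_iff_map_eq_zero]
    intro y hy
    obtain ⟨z, rfl⟩ := ex₂ I h2 i y hy
    exact hT0 z
  · intro y
    rw [LinearMap.comp_apply]
    obtain ⟨z, hz⟩ := hd1 (hm I (inv Ψ.τ₁) (i + 1) y)
    rw [← hz, hs, hδ_nat I h1 h2 Ψ, hz, ← hm_comp, IsIso.inv_hom_id]
    exact post_id I _

lemma tors_se {M : Type} [AddCommGroup M] [Module R M] (Γ : Submodule R M) :
    (sc Γ.subtype Γ.mkQ (LinearMap.exact_subtype_mkQ _)).ShortExact :=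
  sc_se Γ.subtype Γ.mkQ (LinearMap.exact_subtype_mkQ _)
      (Submodule.subtype_injective _) (Submodule.mkQ_surjective _)

lemma tors_van [IsNoetherianRing R] (I : Ideal R)
    {M : Type} [AddCommGroup M] [Module R M] (Γ : Submodule R M)
    (k₀ : ℕ) (hk₀ : ∀ r ∈ I ^ k₀, ∀ g : Γ, r • g = 0) (j : ℕ)
    (z : HH I (sc Γ.subtype Γ.mkQ (LinearMap.exact_subtype_mkQ _)).X₁ (j + 1)) : z = 0 :=
  HH_van I _ k₀ hk₀ j z

lemma tors_surj [IsNoetherianRing R] (I : Ideal R)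
    {M : Type} [AddCommGroup M] [Module R M] (Γ : Submodule R M)
    (k₀ : ℕ) (hk₀ : ∀ r ∈ I ^ k₀, ∀ g : Γ, r • g = 0) (j : ℕ) (y) :
    ∃ z, hm I (ModuleCat.ofHom Γ.mkQ) j z = y :=
  surj_of_van I (tors_se Γ) (tors_van I Γ k₀ hk₀) j y

lemma tors_equiv [IsNoetherianRing R] (I : Ideal R)
    {M : Type} [AddCommGroup M] [Module R M] (Γ : Submodule R M)
    (k₀ : ℕ) (hk₀ : ∀ r ∈ I ^ k₀, ∀ g : Γ, r • g = 0) (j : ℕ) :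
    Nonempty (HH I (ModuleCat.of R (M ⧸ Γ)) (j + 1) ≃ₗ[R] HH I (ModuleCat.of R M) (j + 1)) :=
  equiv_of_van I (tors_se Γ) (tors_van I Γ k₀ hk₀) j

set_option maxHeartbeats 1000000 in
theorem main [IsNoetherianRing R] (I : Ideal R)
    (M : Type) [AddCommGroup M] [Module R M] [Module.Finite R M]
    (t n : ℕ) (ht : 0 < t)
    (hann : ∀ i < t, ∀ r ∈ I ^ n, ∀ y : HH I (ModuleCat.of R M) i, r • y = 0)
    (x : R) (hx : x ∈ I ^ n * I ^ n)
    (hfr : ∀ p ∈ associatedPrimes R M, ¬ I ≤ p → x ∉ p) (i : ℕ) (hi : i + 1 < t) :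
    Nonempty (HH I (ModuleCat.of R (M ⧸ (Ideal.span {x} • (⊤ : Submodule R M)))) i ≃ₗ[R]
      HH I (ModuleCat.of R M) i × HH I (ModuleCat.of R M) (i + 1)) := by
  obtain ⟨Γ, hΓ⟩ : ∃ Γ : Submodule R M, Γ = Submodule.torsionBy R M x := ⟨_, rfl⟩
  have hΓm : ∀ m, x • m = 0 → m ∈ Γ := fun m hm => by rw [hΓ]; exact hm
  obtain ⟨k₀, hk₀⟩ := tors_pow I M x hfr
  rw [← hΓ] at hk₀
  have hkill : ∀ r ∈ I ^ n, ∀ m ∈ Γ, r • m = 0 := fun r hr m hm =>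
    tors_kill I M k₀ m (fun s hs => congr_arg Subtype.val (hk₀ s hs ⟨m, hm⟩)) r
      (hann 0 ht r hr)
  have hπs := tors_surj I Γ k₀ hk₀
  obtain ⟨E⟩ := tors_equiv I Γ k₀ hk₀ i
  -- multiplication maps
  have hsub : I ^ n * I ^ n ≤ I ^ n := Ideal.mul_le_left
  let φ (b : R) (hb : b ∈ I ^ n) : (M ⧸ Γ) →ₗ[R] M :=
    Γ.liftQ (LinearMap.lsmul R M b) (fun m hm => hkill b hb m hm)
  have hφ0 : ∀ (b : R) (hb : b ∈ I ^ n) (j : ℕ) (_ : j < t) (y),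
      hm I (ModuleCat.ofHom (φ b hb)) j y = 0 := by
    intro b hb j hj y
    obtain ⟨z, rfl⟩ := hπs j y
    rw [← hm_comp]
    have : ModuleCat.ofHom Γ.mkQ ≫ ModuleCat.ofHom (φ b hb) = b • 𝟙 (ModuleCat.of R M) := by ext; rfl
    rw [this, hm_smul]
    exact hann j hj b hb _
  obtain ⟨k, a, b, ha, hb, hxab⟩ := mem_mul_sum _ _ x hx
  let Φ : (M ⧸ Γ) →ₗ[R] (Fin k → M) := LinearMap.pi fun j => φ (b j) (hb j)
  let α : (Fin k → M) →ₗ[R] M := ∑ j, a j • LinearMap.proj j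
  have hx' : x ∈ I ^ n := hsub hx
  have hαΦ : ∀ y, α (Φ y) = φ x hx' y := by
    intro y
    obtain ⟨m, rfl⟩ := Γ.mkQ_surjective y
    have : φ x hx' (Γ.mkQ m) = x • m := rfl
    rw [this, hxab, Finset.sum_smul]
    simp only [α, LinearMap.sum_apply, LinearMap.smul_apply, LinearMap.proj_apply, mul_smul]
    rfl
  have hφx : Function.Injective (φ x hx') := by
    rw [injective_iff_map_eq_zero]
    intro y hy
    obtain ⟨m, rfl⟩ := Γ.mkQ_surjective y
    exact (Submodule.Quotient.mk_eq_zero _).2 (hΓm m hy)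
  have hΦ : Function.Injective Φ := fun y z h => hφx (by rw [← hαΦ, ← hαΦ, h])
  have h1 := sc_se Φ (LinearMap.range Φ).mkQ (LinearMap.exact_map_mkQ_range Φ) hΦ
    (Submodule.mkQ_surjective _)
  set X : Submodule R M := Ideal.span {x} • (⊤ : Submodule R M) with hX
  have hXr : X = LinearMap.range (φ x hx') := by
    ext m
    rw [hX, Submodule.ideal_span_singleton_smul, Submodule.mem_smul_pointwise_iff_exists]
    constructor
    · rintro ⟨m', -, rfl⟩
      exact ⟨Γ.mkQ m', rfl⟩
    · rintro ⟨y, rfl⟩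
      obtain ⟨m', rfl⟩ := Γ.mkQ_surjective y
      exact ⟨m', trivial, rfl⟩
  have hex2 : Function.Exact (φ x hx') X.mkQ := by
    rw [LinearMap.exact_iff, Submodule.ker_mkQ, hXr]
  have h2 := sc_se (φ x hx') X.mkQ hex2 hφx (Submodule.mkQ_surjective _)
  let β : ((Fin k → M) ⧸ LinearMap.range Φ) →ₗ[R] (M ⧸ X) :=
    Submodule.mapQ _ _ α (by
      rintro _ ⟨y, rfl⟩
      rw [Submodule.mem_comap, hαΦ, hXr]
      exact ⟨y, rfl⟩)
  let Ψ : sc Φ (LinearMap.range Φ).mkQ (LinearMap.exact_map_mkQ_range Φ) ⟶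
      sc (φ x hx') X.mkQ hex2 :=
    { τ₁ := 𝟙 _
      τ₂ := ModuleCat.ofHom α
      τ₃ := ModuleCat.ofHom β
      comm₁₂ := by
        refine ModuleCat.hom_ext (LinearMap.ext fun y => ?_)
        exact (hαΦ y).symm
      comm₂₃ := by ext; rfl }
  -- vanishing of the two maps
  have hΦ0 : ∀ y, hm I (ModuleCat.ofHom Φ) (i + 1) y = 0 := by
    intro y
    have : ModuleCat.ofHom Φ = ∑ j, ModuleCat.ofHom (φ (b j) (hb j)) ≫
        ModuleCat.ofHom (LinearMap.single R (fun _ : Fin k => M) j) := by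
      refine ModuleCat.hom_ext (LinearMap.ext fun y => ?_)
      rw [ModuleCat.hom_sum, LinearMap.sum_apply]
      exact (LinearMap.sum_single_apply (fun _ : Fin k => M) (Φ y)).symm
    rw [this, hm_sum]
    refine Finset.sum_eq_zero fun j _ => ?_
    rw [hm_comp, hφ0 _ (hb j) _ hi, map_zero]
  have hα0 : ∀ y, hm I (ModuleCat.ofHom α) i y = 0 := by
    intro y
    have : ModuleCat.ofHom α = ∑ j, a j •
        ModuleCat.ofHom (LinearMap.proj (R := R) (φ := fun _ : Fin k => M) j) := by
      refine ModuleCat.hom_ext ?_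
      rw [ModuleCat.hom_sum]
      rfl
    rw [this, hm_sum]
    refine Finset.sum_eq_zero fun j _ => ?_
    rw [hm_smul]
    exact hann i (by omega) _ (ha j) _
  have hiso : IsIso Ψ.τ₁ := inferInstanceAs (IsIso (𝟙 _))
  obtain ⟨e⟩ := split_of_hom I h1 h2 Ψ i (hφ0 x hx' i (by omega)) hΦ0 hα0
  exact ⟨e.trans (LinearEquiv.prodCongr (LinearEquiv.refl R _) E)⟩

end main
end LCSplit

/-- **Splitting theorem for local cohomology** (Theorem 1.1, first part).
If `𝔞 ^ n₀` annihilates `H^i_𝔞(M)` for all `i < t`, then for every `𝔞`-filter regular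
element `x ∈ 𝔞 ^ (2 * n₀)` of `M` and all `i < t - 1` we have
`H^i_𝔞(M/xM) ≅ H^i_𝔞(M) ⊕ H^{i+1}_𝔞(M)`. -/
theorem localCohomology_quotient_splitting
    {R : Type} [CommRing R] [IsNoetherianRing R] (𝔞 : Ideal R)
    (M : Type) [AddCommGroup M] [Module R M] [Module.Finite R M]
    (t n₀ : ℕ) (ht : 0 < t) (hn₀ : 0 < n₀)
    (hann : ∀ i < t, 𝔞 ^ n₀ ≤ Module.annihilator R
      ((localCohomology 𝔞 i).obj (ModuleCat.of R M)))
    (x : R) (hx : x ∈ 𝔞 ^ (2 * n₀))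
    (hfr : ∀ p ∈ associatedPrimes R M, ¬ 𝔞 ≤ p → x ∉ p) :
    ∀ i, i + 1 < t →
      Nonempty (((localCohomology 𝔞 i).obj
          (ModuleCat.of R (M ⧸ (Ideal.span {x} • (⊤ : Submodule R M))))) ≃ₗ[R]
        ((localCohomology 𝔞 i).obj (ModuleCat.of R M)) ×
        ((localCohomology 𝔞 (i + 1)).obj (ModuleCat.of R M))) := by
  intro i hi
  obtain ⟨e⟩ := LCSplit.main 𝔞 M t n₀ ht (by
    intro j hj r hr y
    apply (LCSplit.oldEquiv 𝔞 (ModuleCat.of R M) j).injective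
    rw [map_smul, map_zero]
    exact Module.mem_annihilator.1 (hann j hj hr) _) x
    (by rwa [← pow_add, ← two_mul]) hfr i hi
  exact ⟨(LCSplit.oldEquiv 𝔞 _ i).symm.trans (e.trans
    (LinearEquiv.prodCongr (LCSplit.oldEquiv 𝔞 _ i) (LCSplit.oldEquiv 𝔞 _ (i + 1))))⟩
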